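/- Let B be the ring of integers of a number field, a, b, c ∈ B, A = B[X,Y]/(aX² + bXY + cY² − 1), and let Γ be the (finite) set of prime ideals P of B with (2, b)B ⊆ P and (a, c)B ⊄ P. For each P ∈ Γ choose d, e ∈ B with d² ≡ a, e² ≡ c (mod P) and define F_P as in the context; let I_P be the ideal of A generated by the image of P together with the images of all polynomials x·F_P for x ∈ P⁻¹, and let H = ∏_{P ∈ Γ} I_P. Then the singular locus of A equals V(H): for every prime ideal M of A, the localization A_M fails to be a regular local ring if and only if H ⊆ M. -/

import Mathlib

open MvPolynomial NumberField
open scoped nonZeroDivisors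

/-- A commutative local ring `R` is a regular local ring if it is Noetherian and its maximal
ideal can be generated by `dim R` elements (where `dim` is the Krull dimension). -/
def IsRegularLocal (R : Type*) [CommRing R] [IsLocalRing R] : Prop :=
  IsNoetherianRing R ∧
    ∃ s : Finset R, Ideal.span (s : Set R) = IsLocalRing.maximalIdeal R ∧
      (s.card : WithBot ℕ∞) = ringKrullDim R

/-- The polynomial `a X² + b XY + c Y² - 1` in `B[X,Y]`. -/
noncomputable abbrev quadPoly {B : Type*} [CommRing B] (a b c : B) :
    MvPolynomial (Fin 2) B :=
  C a * X 0 ^ 2 + C b * X 0 * X 1 + C c * X 1 ^ 2 - 1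

/-- The ring `A = B[X,Y]/(a X² + b XY + c Y² - 1)`. -/
noncomputable abbrev QuadAlg (B : Type*) [CommRing B] (a b c : B) :=
  MvPolynomial (Fin 2) B ⧸ Ideal.span {quadPoly a b c}

/-- The definition of regularity by generators agrees with Mathlib's `IsRegularLocalRing`. -/
lemma isRegularLocal_iff {R : Type*} [CommRing R] [IsLocalRing R] :
    IsRegularLocal R ↔ IsRegularLocalRing R := by
  constructor
  · rintro ⟨hN, s, hs, hc⟩
    apply IsRegularLocalRing.of_spanFinrank_maximalIdeal_le
    rw [← hc, ← hs]
    have := Submodule.spanFinrank_span_le_ncard_of_finite (R := R) s.finite_toSet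
    rw [Set.ncard_coe_finset] at this
    exact_mod_cast this
  · intro h
    have hfg := (IsLocalRing.maximalIdeal R).fg_of_isNoetherianRing
    refine ⟨inferInstance, (Submodule.FG.finite_generators hfg).toFinset, ?_, ?_⟩
    · rw [Set.Finite.coe_toFinset]
      exact (IsLocalRing.maximalIdeal R).span_generators
    · rw [← Set.ncard_eq_toFinset_card _ (Submodule.FG.finite_generators hfg),
        Submodule.FG.generators_ncard hfg]
      exact IsRegularLocalRing.spanFinrank_maximalIdeal

section Local

open IsLocalRing

variable {S T : Type*} [CommRing S] [CommRing T]

lemma ringKrullDim_add_one_of_ker_eq_span [IsLocalRing S] [IsNoetherianRing S] (ψ : S →+* T)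
    (hψ : Function.Surjective ψ) {f : S} (hf : f ∈ nonZeroDivisors S) (hfm : f ∈ maximalIdeal S)
    (hker : RingHom.ker ψ = Ideal.span {f}) : ringKrullDim T + 1 = ringKrullDim S := by
  rw [← ringKrullDim_quotient_span_singleton_succ_eq_ringKrullDim_of_mem_nonZeroDivisors hf hfm,
    ← hker, ringKrullDim_eq_of_ringEquiv (RingHom.quotientKerEquivOfSurjective hψ)]

/-- If a quotient of a Noetherian local ring by a regular element `f` is regular, then `f` is not
in the square of the maximal ideal. -/
lemma notMem_sq_of_isRegularLocal [IsLocalRing S] [IsNoetherianRing S] [IsLocalRing T] (ψ : S →+* T)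
    (hψ : Function.Surjective ψ) {f : S} (hf : f ∈ nonZeroDivisors S) (hfm : f ∈ maximalIdeal S)
    (hker : RingHom.ker ψ = Ideal.span {f}) (hT : IsRegularLocal T) :
    f ∉ maximalIdeal S ^ 2 := by
  classical
  intro hf2
  obtain ⟨-, s, hs, hc⟩ := hT
  set s' : Finset S := s.image (Function.surjInv hψ) with hs'
  have himg : ψ '' (s' : Set S) = s := by
    rw [hs', Finset.coe_image, ← Set.image_comp, Function.comp_surjInv hψ, Set.image_id]
  have hmap : (Ideal.span (s' : Set S)).map ψ = maximalIdeal T := by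
    rw [Ideal.map_span, himg, hs]
  have hcomap : maximalIdeal S ≤ Ideal.span (s' : Set S) ⊔ Ideal.span {f} := by
    rw [← hker, RingHom.ker_eq_comap_bot, ← Ideal.comap_map_of_surjective ψ hψ, hmap,
      ← map_maximalIdeal_of_surjective ψ hψ]
    exact Ideal.le_comap_map
  have hle : maximalIdeal S ≤ Ideal.span (s' : Set S) := by
    refine Submodule.le_of_le_smul_of_le_jacobson_bot (I := maximalIdeal S)
      (maximalIdeal S).fg_of_isNoetherianRing (maximalIdeal_le_jacobson _) ?_
    refine hcomap.trans (sup_le_sup_left ?_ _)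
    rw [Ideal.span_singleton_le_iff_mem, smul_eq_mul, ← pow_two]
    exact hf2
  have heq : maximalIdeal S = Ideal.span (s' : Set S) := by
    refine le_antisymm hle (Ideal.span_le.mpr fun x hx => ?_)
    have hx' : ψ x ∈ maximalIdeal T := hmap ▸ Ideal.mem_map_of_mem ψ (Ideal.subset_span hx)
    rw [SetLike.mem_coe, mem_maximalIdeal, mem_nonunits_iff]
    rw [mem_maximalIdeal, mem_nonunits_iff] at hx'
    exact fun h => hx' (h.map ψ)
  have h1 := ringKrullDim_le_spanFinrank_maximalIdeal S
  have h2 : (maximalIdeal S).spanFinrank ≤ s.card := by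
    rw [heq]
    refine (Submodule.spanFinrank_span_le_ncard_of_finite s'.finite_toSet).trans ?_
    rw [Set.ncard_coe_finset]
    exact Finset.card_image_le
  rw [← ringKrullDim_add_one_of_ker_eq_span ψ hψ hf hfm hker, ← hc] at h1
  have h3 : s.card + 1 ≤ (maximalIdeal S).spanFinrank := by exact_mod_cast h1
  omega

/-- An element of the maximal ideal outside its square is part of a minimal generating set. -/
lemma exists_finset_span_insert_eq_maximalIdeal [IsLocalRing S] [IsNoetherianRing S] {f : S}
    (hfm : f ∈ maximalIdeal S) (hf2 : f ∉ maximalIdeal S ^ 2) :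
    ∃ s : Finset S, s.card + 1 = (maximalIdeal S).spanFinrank ∧
      Ideal.span {f} ⊔ Ideal.span (s : Set S) = maximalIdeal S := by
  classical
  have hfg := (maximalIdeal S).fg_of_isNoetherianRing
  set G := (Submodule.FG.finite_generators hfg).toFinset with hG
  have hGspan : Ideal.span (G : Set S) = maximalIdeal S := by
    rw [hG, Set.Finite.coe_toFinset]
    exact (maximalIdeal S).span_generators
  have hGc : G.card = (maximalIdeal S).spanFinrank := by
    rw [hG, ← Set.ncard_eq_toFinset_card _ (Submodule.FG.finite_generators hfg),
        Submodule.FG.generators_ncard hfg]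
  have hGm : ∀ g ∈ G, g ∈ maximalIdeal S := fun g hg => hGspan ▸ Ideal.subset_span hg
  have hf' := hfm
  rw [← hGspan] at hf'
  obtain ⟨c, -, hc⟩ := Submodule.mem_span_finset.mp hf'
  obtain ⟨g, hg, hcg⟩ : ∃ g ∈ G, c g ∉ maximalIdeal S := by
    by_contra! h
    apply hf2
    rw [← hc, pow_two]
    exact Ideal.sum_mem _ fun g hg => Ideal.mul_mem_mul (h g hg) (hGm g hg)
  refine ⟨G.erase g, by rw [Finset.card_erase_add_one hg, hGc], le_antisymm ?_ ?_⟩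
  · refine sup_le ((Ideal.span_singleton_le_iff_mem _).mpr hfm) (Ideal.span_le.mpr fun x hx => ?_)
    exact hGm x (Finset.mem_of_mem_erase hx)
  · have hsub : ∀ x ∈ G.erase g, x ∈ Ideal.span {f} ⊔ Ideal.span ((G.erase g : Finset S) : Set S) :=
      fun x hx => Ideal.mem_sup_right (Ideal.subset_span hx)
    rw [← hGspan, Ideal.span_le]
    intro x hx
    by_cases hxg : x = g
    · subst hxg
      have hu : IsUnit (c x) := by simpa using hcg
      rw [← Finset.add_sum_erase _ _ hg] at hc
      have : c x * x ∈ Ideal.span {f} ⊔ Ideal.span ((G.erase x : Finset S) : Set S) := by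
        rw [← eq_sub_iff_add_eq] at hc
        rw [← smul_eq_mul, hc]
        exact Ideal.sub_mem _ (Ideal.mem_sup_left (Ideal.mem_span_singleton_self f))
          (Ideal.sum_mem _ fun y hy => Ideal.mul_mem_left _ _ (hsub y hy))
      exact (Ideal.unit_mul_mem_iff_mem _ hu).mp this
    · exact hsub x (Finset.mem_erase.mpr ⟨hxg, hx⟩)

lemma isRegularLocal_of_notMem_sq [IsRegularLocalRing S] [IsLocalRing T] (ψ : S →+* T)
    (hψ : Function.Surjective ψ) {f : S} (hf : f ∈ nonZeroDivisors S) (hfm : f ∈ maximalIdeal S)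
    (hker : RingHom.ker ψ = Ideal.span {f}) (hf2 : f ∉ maximalIdeal S ^ 2) :
    IsRegularLocal T := by
  classical
  have : IsNoetherianRing T := isNoetherianRing_of_surjective S T ψ hψ
  obtain ⟨s, hsc, hs⟩ := exists_finset_span_insert_eq_maximalIdeal hfm hf2
  rw [isRegularLocal_iff]
  apply IsRegularLocalRing.of_spanFinrank_maximalIdeal_le
  have hdim := ringKrullDim_add_one_of_ker_eq_span ψ hψ hf hfm hker
  rw [← IsRegularLocalRing.spanFinrank_maximalIdeal (R := S), ← hsc, Nat.cast_add,
    Nat.cast_one] at hdim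
  have hmT : maximalIdeal T = Ideal.span ((s.image ψ : Finset T) : Set T) := by
    rw [← map_maximalIdeal_of_surjective ψ hψ, ← hs, Ideal.map_sup, ← hker,
      (Ideal.map_eq_bot_iff_le_ker ψ).mpr le_rfl, bot_sup_eq, Ideal.map_span, Finset.coe_image]
  have hle : (maximalIdeal T).spanFinrank ≤ s.card := by
    rw [hmT]
    refine (Submodule.spanFinrank_span_le_ncard_of_finite (Finset.finite_toSet _)).trans ?_
    rw [Set.ncard_coe_finset]
    exact Finset.card_image_le
  obtain ⟨n, hn⟩ : ∃ n : ℕ, ringKrullDim T = n := by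
    have h1 := ringKrullDim_le_spanFinrank_maximalIdeal T
    have h0 : (0 : WithBot ℕ∞) ≤ ringKrullDim T := ringKrullDim_nonneg_of_nontrivial
    cases h : ringKrullDim T with
    | bot => simp [h] at h0
    | coe m =>
      cases m with
      | top => rw [h] at h1; exact absurd (WithBot.coe_le_coe.mp h1) (by simp)
      | coe m => exact ⟨m, rfl⟩
  rw [hn] at hdim ⊢
  have : n + 1 = s.card + 1 := by exact_mod_cast hdim
  have : (maximalIdeal T).spanFinrank ≤ n := by omega
  exact_mod_cast this

end Local

section Localization

variable {R A : Type*} [CommRing R] [CommRing A]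

/-- Regularity at a prime `M` of a quotient of a regular domain whose kernel becomes principal,
generated by `f`, after localization: it fails exactly if `f` lies in the square of the preimage
`N` of `M` locally at `N`. -/
lemma isRegularLocal_localization_iff [IsDomain R] [IsRegularRing R] (φ : R →+* A)
    (hφ : Function.Surjective φ) (M : Ideal A) [M.IsPrime] (N : Ideal R) (hN : N = M.comap φ)
    {f t : R} (hf0 : f ≠ 0) (hf : φ f = 0) (ht : t ∉ N) (hker : ∀ y, φ y = 0 → f ∣ t * y) :
    IsRegularLocal (Localization.AtPrime M) ↔ ∀ s, s ∉ N → s * f ∉ N ^ 2 := by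
  have hNp : N.IsPrime := hN ▸ Ideal.comap_isPrime φ M
  have hmap : N.primeCompl.map φ = M.primeCompl := by
    ext y
    simp only [Submonoid.mem_map, Ideal.mem_primeCompl_iff, hN, Ideal.mem_comap]
    constructor
    · rintro ⟨x, hx, rfl⟩
      exact hx
    · intro hy
      obtain ⟨x, rfl⟩ := hφ y
      exact ⟨x, hy, rfl⟩
  have hle : N.primeCompl ≤ M.primeCompl.comap φ := by
    rw [← hmap]; exact Submonoid.le_comap_map _
  set ψ : Localization.AtPrime N →+* Localization.AtPrime M :=
    IsLocalization.map (Localization.AtPrime M) φ hle with hψdef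
  have hψ : Function.Surjective ψ := by
    intro z
    obtain ⟨x, y, rfl⟩ := IsLocalization.exists_mk'_eq M.primeCompl z
    obtain ⟨x', rfl⟩ := hφ x
    obtain ⟨y', hy', hyy⟩ : (y : A) ∈ N.primeCompl.map φ := by
      rw [hmap]; exact y.2
    refine ⟨IsLocalization.mk' _ x' (⟨y', hy'⟩ : N.primeCompl), ?_⟩
    rw [hψdef, IsLocalization.map_mk']
    congr 1
    exact Subtype.ext hyy
  have hkerψ : RingHom.ker ψ = Ideal.span {algebraMap R (Localization.AtPrime N) f} := by
    rw [hψdef, IsLocalization.ker_map (Localization.AtPrime M) φ hmap]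
    apply le_antisymm
    · rw [Ideal.map_le_iff_le_comap]
      intro y hy
      rw [Ideal.mem_comap, Ideal.mem_span_singleton]
      have h := map_dvd (algebraMap R (Localization.AtPrime N)) (hker y hy)
      rw [map_mul] at h
      have hu := IsLocalization.map_units (Localization.AtPrime N) (⟨t, ht⟩ : N.primeCompl)
      exact (hu.dvd_mul_left).mp h
    · rw [Ideal.span_singleton_le_iff_mem]
      exact Ideal.mem_map_of_mem _ hf
  have hinj := IsLocalization.injective (Localization.AtPrime N) N.primeCompl_le_nonZeroDivisors
  have hdom : IsDomain (Localization.AtPrime N) :=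
    IsLocalization.isDomain_localization N.primeCompl_le_nonZeroDivisors
  have hnzd : algebraMap R (Localization.AtPrime N) f ∈ nonZeroDivisors (Localization.AtPrime N) :=
    mem_nonZeroDivisors_of_ne_zero ((map_ne_zero_iff _ hinj).mpr hf0)
  have hfN : f ∈ N := by simp [hN, hf]
  have hfm : algebraMap R (Localization.AtPrime N) f ∈
      IsLocalRing.maximalIdeal (Localization.AtPrime N) := by
    rw [← Localization.AtPrime.map_eq_maximalIdeal]
    exact Ideal.mem_map_of_mem _ hfN
  have hsq : algebraMap R (Localization.AtPrime N) f ∈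
      IsLocalRing.maximalIdeal (Localization.AtPrime N) ^ 2 ↔ ∃ s ∈ N.primeCompl, s * f ∈ N ^ 2 := by
    rw [← Localization.AtPrime.map_eq_maximalIdeal, ← Ideal.map_pow,
      IsLocalization.algebraMap_mem_map_algebraMap_iff N.primeCompl]
  have key : IsRegularLocal (Localization.AtPrime M) ↔ algebraMap R (Localization.AtPrime N) f ∉
      IsLocalRing.maximalIdeal (Localization.AtPrime N) ^ 2 :=
    ⟨notMem_sq_of_isRegularLocal ψ hψ hnzd hfm hkerψ,
      isRegularLocal_of_notMem_sq ψ hψ hnzd hfm hkerψ⟩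
  rw [key, hsq]
  simp only [Ideal.mem_primeCompl_iff]
  push Not
  rfl

end Localization

section Uniformizer

variable {B : Type*} [CommRing B]

/-- A nonzero prime of a Dedekind domain is, locally at itself, generated by one element. -/
lemma Ideal.exists_dvd_mul_of_isPrime [IsDedekindDomain B] (P : Ideal B) [P.IsPrime] (hP : P ≠ ⊥) :
    ∃ π ∈ P, π ≠ 0 ∧ ∃ t ∉ P, ∀ y ∈ P, π ∣ t * y := by
  obtain ⟨π, hπ, hπ2⟩ := P.exists_mem_pow_notMem_pow_succ hP (Ideal.IsPrime.ne_top ‹_›) 1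
  rw [pow_one] at hπ
  obtain ⟨J, hJ⟩ := Ideal.dvd_span_singleton.mpr hπ
  have hJP : ¬ J ≤ P := by
    intro h
    apply hπ2
    have := (Ideal.mul_mono_right h : P * J ≤ P * P)
    rw [← hJ, Ideal.span_singleton_le_iff_mem, ← pow_two] at this
    exact this
  obtain ⟨t, htJ, htP⟩ := Set.not_subset.mp hJP
  refine ⟨π, hπ, ?_, t, htP, fun y hy => ?_⟩
  · rintro rfl
    exact hπ2 (Ideal.zero_mem _)
  · rw [← Ideal.mem_span_singleton, hJ, mul_comm t]
    exact Ideal.mul_mem_mul hy htJ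

variable {σ : Type*}

lemma MvPolynomial.C_dvd_C_mul_of_map_eq_zero {P : Ideal B} {π t : B} (h : ∀ y ∈ P, π ∣ t * y)
    {p : MvPolynomial σ B} (hp : MvPolynomial.map (Ideal.Quotient.mk P) p = 0) :
    C π ∣ C t * p := by
  rw [C_dvd_iff_dvd_coeff]
  intro i
  rw [coeff_C_mul]
  apply h
  rw [← Ideal.Quotient.eq_zero_iff_mem, ← coeff_map, hp, coeff_zero]

/-- A local generator of a nonzero prime `P` of a Dedekind domain `B` is not in the square of a
prime of `B[X₁, …, Xₙ]` above `P`, even locally. -/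
lemma MvPolynomial.mul_C_notMem_sq [IsDedekindDomain B] [Finite σ] (P : Ideal B) [P.IsMaximal]
    {π t : B} (hπ : π ∈ P)
    (hπ0 : π ≠ 0) (ht : t ∉ P) (h : ∀ y ∈ P, π ∣ t * y) (N : Ideal (MvPolynomial σ B)) [N.IsPrime]
    (hN : N.comap C = P) {s : MvPolynomial σ B} (hs : s ∉ N) : s * C π ∉ N ^ 2 := by
  let φ : MvPolynomial σ B →+* MvPolynomial σ (B ⧸ P) := MvPolynomial.map (Ideal.Quotient.mk P)
  have hφ : Function.Surjective φ := map_surjective _ Ideal.Quotient.mk_surjective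
  have hCt : C t ∉ N := fun h => ht (hN ▸ h)
  have hCπ : C π ∈ N := by rwa [← Ideal.mem_comap, hN]
  have hkerN : RingHom.ker φ ≤ N := by
    intro y hy
    have h1 := C_dvd_C_mul_of_map_eq_zero h (RingHom.mem_ker.mp hy)
    exact (Ideal.IsPrime.mem_or_mem ‹_› (Ideal.mem_of_dvd _ h1 hCπ)).resolve_left hCt
  have hM : (N.map φ).IsPrime := Ideal.map_isPrime_of_surjective hφ hkerN
  have hcomap : N = (N.map φ).comap φ := by
    rw [Ideal.comap_map_of_surjective φ hφ, ← RingHom.ker_eq_comap_bot, sup_eq_left.mpr hkerN]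
  let : Field (B ⧸ P) := Ideal.Quotient.field P
  have hreg : IsRegularLocal (Localization.AtPrime (N.map φ)) := by
    rw [isRegularLocal_iff]; infer_instance
  refine (isRegularLocal_localization_iff φ hφ (N.map φ) N hcomap (f := C π) (t := C t)
    (by simpa using hπ0) ?_ hCt fun y hy => C_dvd_C_mul_of_map_eq_zero h hy).mp hreg s hs
  simp only [φ, map_C, Ideal.Quotient.eq_zero_iff_mem.mpr hπ, map_zero]

/-- For a polynomial `F` with coefficients in `P`, all multiples of `F` by elements of `P⁻¹` lie
in a prime `N` above `P` exactly if `F` is in the square of `N`, locally at `N`. -/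
lemma MvPolynomial.forall_inv_smul_mem_iff [IsDedekindDomain B] [Finite σ] (P : Ideal B) [P.IsMaximal]
    (hP : P ≠ ⊥)
    (N : Ideal (MvPolynomial σ B)) [N.IsPrime] (hN : N.comap C = P) (F : MvPolynomial σ B)
    (hF : MvPolynomial.map (Ideal.Quotient.mk P) F = 0) :
    (∀ x ∈ (P : FractionalIdeal B⁰ (FractionRing B))⁻¹, ∀ G : MvPolynomial σ B,
      MvPolynomial.map (algebraMap B (FractionRing B)) G =
        x • MvPolynomial.map (algebraMap B (FractionRing B)) F → G ∈ N) ↔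
      ∃ s, s ∉ N ∧ s * F ∈ N ^ 2 := by
  obtain ⟨π, hπ, hπ0, t, ht, h⟩ := P.exists_dvd_mul_of_isPrime hP
  have hP0 : (P : FractionalIdeal B⁰ (FractionRing B)) ≠ 0 := by
    rwa [Ne, FractionalIdeal.coeIdeal_eq_zero]
  have hCt : C t ∉ N := fun h => ht (hN ▸ h)
  have hCπ : C π ∈ N := by rwa [← Ideal.mem_comap, hN]
  have hinj := IsFractionRing.injective B (FractionRing B)
  have hπK : algebraMap B (FractionRing B) π ≠ 0 := (map_ne_zero_iff _ hinj).mpr hπ0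
  obtain ⟨G, hG⟩ := C_dvd_C_mul_of_map_eq_zero h hF
  constructor
  · intro hall
    have hGN : G ∈ N := by
      refine hall (algebraMap B _ t / algebraMap B _ π) ?_ G ?_
      · rw [FractionalIdeal.mem_inv_iff hP0]
        rintro _ ⟨y, hy, rfl⟩
        obtain ⟨r, hr⟩ := h y hy
        rw [FractionalIdeal.mem_one_iff]
        refine ⟨r, ?_⟩
        rw [Algebra.linearMap_apply, div_mul_eq_mul_div, ← map_mul, hr, map_mul,
          mul_div_cancel_left₀ _ hπK]
      · have := congrArg (MvPolynomial.map (algebraMap B (FractionRing B))) hG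
        rw [map_mul, map_mul, map_C, map_C, C_mul', C_mul'] at this
        rw [div_eq_inv_mul, mul_smul, this, smul_smul, inv_mul_cancel₀ hπK, one_smul]
    refine ⟨C t, hCt, ?_⟩
    rw [hG, pow_two]
    exact Ideal.mul_mem_mul hCπ hGN
  · rintro ⟨s, hs, hsF⟩
    have hGN : G ∈ N := by
      by_contra hGN
      refine mul_C_notMem_sq P hπ hπ0 ht h N hN
        (s := s * G) (fun hsG => (Ideal.IsPrime.mem_or_mem ‹_› hsG).elim hs hGN) ?_
      have : s * G * C π = C t * (s * F) := by linear_combination -s * hG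
      rw [this]
      exact Ideal.mul_mem_left _ _ hsF
    intro x hx G' hG'
    obtain ⟨r, hr⟩ := (FractionalIdeal.mem_one_iff _).mp
      ((FractionalIdeal.mem_inv_iff hP0).mp hx _ (FractionalIdeal.mem_coeIdeal_of_mem _ hπ))
    have key : C t * G' = C r * G := by
      have hCπ0 : (C π : MvPolynomial σ B) ≠ 0 := by simpa using hπ0
      apply mul_left_cancel₀ hCπ0
      apply map_injective _ hinj
      have hGK := congrArg (MvPolynomial.map (algebraMap B (FractionRing B))) hG
      have hrK := congrArg (C (σ := σ)) hr
      rw [smul_eq_C_mul] at hG'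
      simp only [map_mul, map_C] at hGK hrK hG' ⊢
      rw [hG']
      linear_combination (C x * C (algebraMap B (FractionRing B) π)) * hGK -
        C (algebraMap B (FractionRing B) π) *
          MvPolynomial.map (algebraMap B (FractionRing B)) G * hrK
    have : C t * G' ∈ N := key ▸ Ideal.mul_mem_left _ _ hGN
    exact (Ideal.IsPrime.mem_or_mem ‹_› this).resolve_left hCt

end Uniformizer

section Quadratic

variable {R : Type*} [CommRing R] {N : Ideal R} {a b c d e x y : R}

lemma add_sub_one_mem_of_quad_mem [N.IsPrime] (h2 : (2 : R) ∈ N) (hb : b ∈ N)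
    (hd : d ^ 2 - a ∈ N) (he : e ^ 2 - c ∈ N) (hf : a * x ^ 2 + b * x * y + c * y ^ 2 - 1 ∈ N) :
    d * x + e * y - 1 ∈ N := by
  apply Ideal.IsPrime.mem_of_pow_mem ‹_› 2
  have : (d * x + e * y - 1) ^ 2 = (a * x ^ 2 + b * x * y + c * y ^ 2 - 1) + x ^ 2 * (d ^ 2 - a) +
      y ^ 2 * (e ^ 2 - c) - x * y * b + (d * e * x * y - d * x - e * y + 1) * 2 := by ring
  rw [this]
  exact add_mem (sub_mem (add_mem (add_mem hf (N.mul_mem_left _ hd)) (N.mul_mem_left _ he))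
    (N.mul_mem_left _ hb)) (N.mul_mem_left _ h2)

lemma quad_sub_mem_sq_of_left [N.IsPrime] (h2 : (2 : R) ∈ N) (hb : b ∈ N) (hd : d ^ 2 - a ∈ N)
    (he : e ^ 2 - c ∈ N) (hf : a * x ^ 2 + b * x * y + c * y ^ 2 - 1 ∈ N) :
    d ^ 2 * (a * x ^ 2 + b * x * y + c * y ^ 2 - 1) -
      ((a * e ^ 2 - b * d * e + c * d ^ 2) * y ^ 2 + (2 * a * e - b * d) * y + (a - d ^ 2)) ∈
      N ^ 2 := by
  have hL := add_sub_one_mem_of_quad_mem h2 hb hd he hf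
  have : d ^ 2 * (a * x ^ 2 + b * x * y + c * y ^ 2 - 1) -
      ((a * e ^ 2 - b * d * e + c * d ^ 2) * y ^ 2 + (2 * a * e - b * d) * y + (a - d ^ 2)) =
      (d * x + e * y - 1) * (a * (d * x + e * y - 1) + (a * (1 - e * y)) * 2 + d * y * b) +
      2 * (d * y * b - a * e * y * 2) := by ring
  rw [this, pow_two]
  exact add_mem
    (Ideal.mul_mem_mul hL (add_mem (add_mem (N.mul_mem_left _ hL) (N.mul_mem_left _ h2))
      (N.mul_mem_left _ hb)))
    (Ideal.mul_mem_mul h2 (sub_mem (N.mul_mem_left _ hb) (N.mul_mem_left _ h2)))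

lemma quad_sub_mem_sq_of_right [N.IsPrime] (h2 : (2 : R) ∈ N) (hb : b ∈ N) (hdN : d ∈ N)
    (hd : d ^ 2 - a ∈ N) (he : e ^ 2 - c ∈ N)
    (hf : a * x ^ 2 + b * x * y + c * y ^ 2 - 1 ∈ N) :
    e ^ 2 * (a * x ^ 2 + b * x * y + c * y ^ 2 - 1) -
      (a * e ^ 2 * x ^ 2 - b * e * x + (c - e ^ 2)) ∈ N ^ 2 := by
  have hL := add_sub_one_mem_of_quad_mem h2 hb hd he hf
  have : e ^ 2 * (a * x ^ 2 + b * x * y + c * y ^ 2 - 1) -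
      (a * e ^ 2 * x ^ 2 - b * e * x + (c - e ^ 2)) =
      (d * x + e * y - 1) *
        (c * (d * x + e * y - 1) + e * x * b + (c * (1 - d * x)) * 2) +
      2 * (e * x * b - c * x * d) + d * (c * x ^ 2 * d - e * x ^ 2 * b) := by ring
  rw [this, pow_two]
  exact add_mem (add_mem
    (Ideal.mul_mem_mul hL (add_mem (add_mem (N.mul_mem_left _ hL) (N.mul_mem_left _ hb))
      (N.mul_mem_left _ h2)))
    (Ideal.mul_mem_mul h2 (sub_mem (N.mul_mem_left _ hb) (N.mul_mem_left _ hdN))))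
    (Ideal.mul_mem_mul hdN (sub_mem (N.mul_mem_left _ hdN) (N.mul_mem_left _ hb)))

end Quadratic

section QuadPoly

variable {B : Type*} [CommRing B] {a b c : B}

lemma quadPoly_ne_zero [Nontrivial B] (a b c : B) : quadPoly a b c ≠ 0 := by
  intro h
  have := congrArg constantCoeff h
  simp at this

lemma Derivation.apply_mem_of_mem_sq {R A : Type*} [CommRing R] [CommRing A] [Algebra R A]
    (D : Derivation R A A) {N : Ideal A} {z : A} (hz : z ∈ N ^ 2) : D z ∈ N := by
  rw [pow_two] at hz
  induction hz using Submodule.mul_induction_on' with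
  | mem_mul_mem m hm n hn =>
    rw [D.leibniz]
    exact add_mem (N.mul_mem_right _ hm) (N.mul_mem_right _ hn)
  | add x _ y _ hx hy => rw [map_add]; exact add_mem hx hy

lemma Derivation.apply_mem_of_mul_mem_sq {R A : Type*} [CommRing R] [CommRing A] [Algebra R A]
    (D : Derivation R A A) {N : Ideal A} [N.IsPrime] {s f : A} (hs : s ∉ N) (hf : f ∈ N)
    (h : s * f ∈ N ^ 2) : D f ∈ N := by
  have h1 := D.apply_mem_of_mem_sq h
  rw [D.leibniz, smul_eq_mul, smul_eq_mul] at h1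
  have h2 : s * D f ∈ N := (Ideal.add_mem_iff_left N (N.mul_mem_right _ hf)).mp h1
  exact (Ideal.IsPrime.mem_or_mem ‹_› h2).resolve_left hs

/-- The Jacobian criterion: a singular point of `a X² + b XY + c Y² = 1` lies over a prime
containing `2` and `b` but not both of `a` and `c`. -/
lemma comap_C_of_mul_quadPoly_mem_sq {N : Ideal (MvPolynomial (Fin 2) B)} [N.IsPrime]
    {s : MvPolynomial (Fin 2) B} (hs : s ∉ N) (hf : quadPoly a b c ∈ N)
    (h : s * quadPoly a b c ∈ N ^ 2) :
    Ideal.span {2, b} ≤ N.comap C ∧ ¬ Ideal.span {a, c} ≤ N.comap C := by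
  have hX := (pderiv (R := B) (0 : Fin 2)).apply_mem_of_mul_mem_sq hs hf h
  have hY := (pderiv (R := B) (1 : Fin 2)).apply_mem_of_mul_mem_sq hs hf h
  have eX : pderiv (0 : Fin 2) (quadPoly a b c) = C a * (2 * X 0) + C b * X 1 := by
    simp [quadPoly, Derivation.leibniz, Derivation.leibniz_pow]
    ring
  have eY : pderiv (1 : Fin 2) (quadPoly a b c) = C b * X 0 + C c * (2 * X 1) := by
    simp [quadPoly, Derivation.leibniz, Derivation.leibniz_pow]
  rw [eX] at hX
  rw [eY] at hY
  have h1 : (1 : MvPolynomial (Fin 2) B) ∉ N :=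
    (Ideal.ne_top_iff_one N).mp (Ideal.IsPrime.ne_top ‹_›)
  have h2 : (2 : MvPolynomial (Fin 2) B) ∈ N := by
    have : (2 : MvPolynomial (Fin 2) B) = X 0 * (C a * (2 * X 0) + C b * X 1) +
        X 1 * (C b * X 0 + C c * (2 * X 1)) - 2 * quadPoly a b c := by
      rw [quadPoly]; ring
    rw [this]
    exact sub_mem (add_mem (N.mul_mem_left _ hX) (N.mul_mem_left _ hY)) (N.mul_mem_left _ hf)
  have hbX : C b * X 0 ∈ N := by
    have : C b * X 0 =
        (C b * X 0 + C c * (2 * X 1)) - (C c * X 1) * (2 : MvPolynomial (Fin 2) B) := by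
      ring
    rw [this]
    exact sub_mem hY (N.mul_mem_left _ h2)
  have hbY : C b * X 1 ∈ N := by
    have : C b * X 1 =
        (C a * (2 * X 0) + C b * X 1) - (C a * X 0) * (2 : MvPolynomial (Fin 2) B) := by
      ring
    rw [this]
    exact sub_mem hX (N.mul_mem_left _ h2)
  have hb : C b ∈ N := by
    by_contra hb
    have hx := (Ideal.IsPrime.mem_or_mem ‹_› hbX).resolve_left hb
    have hy := (Ideal.IsPrime.mem_or_mem ‹_› hbY).resolve_left hb
    apply h1
    have : (1 : MvPolynomial (Fin 2) B) =
        (C a * X 0 + C b * X 1) * X 0 + (C c * X 1) * X 1 - quadPoly a b c := by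
      rw [quadPoly]; ring
    rw [this]
    exact sub_mem (add_mem (N.mul_mem_left _ hx) (N.mul_mem_left _ hy)) hf
  simp only [Ideal.span_le, Set.insert_subset_iff, Set.singleton_subset_iff, SetLike.mem_coe,
    Ideal.mem_comap, map_ofNat]
  refine ⟨⟨h2, hb⟩, fun ⟨ha, hc⟩ => h1 ?_⟩
  have : (1 : MvPolynomial (Fin 2) B) =
      X 0 ^ 2 * C a + X 0 * X 1 * C b + X 1 ^ 2 * C c - quadPoly a b c := by
    rw [quadPoly]; ring
  rw [this]
  exact sub_mem (add_mem (add_mem (N.mul_mem_left _ ha) (N.mul_mem_left _ hb))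
    (N.mul_mem_left _ hc)) hf

lemma exists_mul_mem_iff_of_sub_mem {R : Type*} [CommRing R] {N J : Ideal R} [N.IsPrime]
    {u f g : R} (hu : u ∉ N) (h : u * f - g ∈ J) :
    (∃ s, s ∉ N ∧ s * f ∈ J) ↔ ∃ s, s ∉ N ∧ s * g ∈ J := by
  constructor
  · rintro ⟨s, hs, hsf⟩
    refine ⟨s, hs, ?_⟩
    have : s * g = u * (s * f) - s * (u * f - g) := by ring
    rw [this]
    exact sub_mem (J.mul_mem_left _ hsf) (J.mul_mem_left _ h)
  · rintro ⟨s, hs, hsg⟩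
    refine ⟨s * u, fun h => (Ideal.IsPrime.mem_or_mem ‹_› h).elim hs hu, ?_⟩
    have : s * u * f = s * (u * f - g) + s * g := by ring
    rw [this]
    exact add_mem (J.mul_mem_left _ h) hsg

/-- Above a prime `P` containing `2` and `b` but not both `a` and `c`, the polynomial
`a X² + b XY + c Y² - 1` can be replaced by a polynomial with coefficients in `P`. -/
lemma exists_mul_quadPoly_mem_sq_iff {P : Ideal B} [P.IsPrime]
    {N : Ideal (MvPolynomial (Fin 2) B)} [N.IsPrime] (hN : N.comap C = P)
    (h2b : Ideal.span {2, b} ≤ P) (hac : ¬ Ideal.span {a, c} ≤ P) {d e : B}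
    (hd : d ^ 2 - a ∈ P) (he : e ^ 2 - c ∈ P) {F : MvPolynomial (Fin 2) B}
    (hF₁ : a ∉ P → F = C (a * e ^ 2 - b * d * e + c * d ^ 2) * X 1 ^ 2 +
      C (2 * a * e - b * d) * X 1 + C (a - d ^ 2))
    (hF₂ : a ∈ P → F = C (a * e ^ 2) * X 0 ^ 2 - C (b * e) * X 0 + C (c - e ^ 2))
    (hf : quadPoly a b c ∈ N) :
    MvPolynomial.map (Ideal.Quotient.mk P) F = 0 ∧
      ((∃ s, s ∉ N ∧ s * quadPoly a b c ∈ N ^ 2) ↔ ∃ s, s ∉ N ∧ s * F ∈ N ^ 2) := by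
  have hC : ∀ r : B, r ∈ P ↔ C r ∈ N := fun r => by rw [← hN, Ideal.mem_comap]
  rw [Ideal.span_le, Set.insert_subset_iff, Set.singleton_subset_iff] at h2b hac
  obtain ⟨h2, hb⟩ := h2b
  simp only [SetLike.mem_coe] at h2 hb hac
  have h2N : (2 : MvPolynomial (Fin 2) B) ∈ N := by
    simpa only [map_ofNat] using (hC 2).mp h2
  have hbN := (hC b).mp hb
  have hdN : C d ^ 2 - C a ∈ N := by simpa using (hC _).mp hd
  have heN : C e ^ 2 - C c ∈ N := by simpa using (hC _).mp he
  set q := MvPolynomial.map (σ := Fin 2) (Ideal.Quotient.mk P) with hqdef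
  have hq : ∀ r ∈ P, q (C r) = 0 :=
    fun r hr => by rw [hqdef, map_C, Ideal.Quotient.eq_zero_iff_mem.mpr hr, C_0]
  by_cases ha : a ∈ P
  · rw [hF₂ ha]
    have hdP : d ∈ P := by
      apply Ideal.IsPrime.mem_of_pow_mem ‹_› 2
      simpa using add_mem hd ha
    have heP : C e ^ 2 ∉ N := by
      rw [← C_pow, ← hC]
      intro h
      exact hac ⟨ha, by simpa using sub_mem h he⟩
    constructor
    · have h1 : a * e ^ 2 ∈ P := P.mul_mem_right _ ha
      have h3 : b * e ∈ P := P.mul_mem_right _ hb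
      have h4 : c - e ^ 2 ∈ P := by rw [← neg_sub]; exact neg_mem he
      rw [q.map_add, q.map_sub, q.map_mul, q.map_mul,
        hq _ h1, hq _ h3, hq _ h4]
      ring
    · refine exists_mul_mem_iff_of_sub_mem heP ?_
      have := quad_sub_mem_sq_of_right h2N hbN ((hC d).mp hdP) hdN heN hf
      simpa only [map_mul, map_sub, map_pow] using this
  · rw [hF₁ ha]
    have hdP : C d ^ 2 ∉ N := by
      rw [← C_pow, ← hC]
      intro h
      exact ha (by simpa using sub_mem h hd)
    constructor
    · have h1 : a * e ^ 2 - b * d * e + c * d ^ 2 ∈ P := by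
        have : a * e ^ 2 - b * d * e + c * d ^ 2 =
            a * (e ^ 2 - c) + c * (d ^ 2 - a) + a * c * 2 - d * e * b := by ring
        rw [this]
        exact sub_mem (add_mem (add_mem (P.mul_mem_left _ he) (P.mul_mem_left _ hd))
          (P.mul_mem_left _ h2)) (P.mul_mem_left _ hb)
      have h3 : 2 * a * e - b * d ∈ P :=
        sub_mem (P.mul_mem_right _ (P.mul_mem_right _ h2)) (P.mul_mem_right _ hb)
      have h4 : a - d ^ 2 ∈ P := by rw [← neg_sub]; exact neg_mem hd
      rw [q.map_add, q.map_add, q.map_mul, q.map_mul,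
        hq _ h1, hq _ h3, hq _ h4]
      ring
    · refine exists_mul_mem_iff_of_sub_mem hdP ?_
      have := quad_sub_mem_sq_of_left h2N hbN hdN heN hf
      simpa only [map_mul, map_sub, map_pow, map_add, map_ofNat] using this

end QuadPoly

theorem singular_locus_eq (K : Type) [Field K] [NumberField K] (a b c : 𝓞 K)
    (Γ : Set (Ideal (𝓞 K)))
    (hΓ : Γ = {P : Ideal (𝓞 K) | P.IsPrime ∧ Ideal.span {(2 : 𝓞 K), b} ≤ P ∧
      ¬ Ideal.span {a, c} ≤ P})
    (hfin : Γ.Finite)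
    (d e : Ideal (𝓞 K) → 𝓞 K)
    (hd : ∀ P ∈ Γ, (d P) ^ 2 - a ∈ P) (he : ∀ P ∈ Γ, (e P) ^ 2 - c ∈ P)
    (F : Ideal (𝓞 K) → MvPolynomial (Fin 2) (𝓞 K))
    (hF₁ : ∀ P ∈ Γ, a ∉ P →
      F P = C (a * (e P) ^ 2 - b * (d P) * (e P) + c * (d P) ^ 2) * X 1 ^ 2 +
        C (2 * a * (e P) - b * (d P)) * X 1 + C (a - (d P) ^ 2))
    (hF₂ : ∀ P ∈ Γ, a ∈ P →
      F P = C (a * (e P) ^ 2) * X 0 ^ 2 - C (b * (e P)) * X 0 + C (c - (e P) ^ 2))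
    (I : Ideal (𝓞 K) → Ideal (QuadAlg (𝓞 K) a b c))
    (hI : ∀ P ∈ Γ, I P = Ideal.span
      ((algebraMap (𝓞 K) (QuadAlg (𝓞 K) a b c)) '' (P : Set (𝓞 K)) ∪
        {z | ∃ x ∈ (P : FractionalIdeal (𝓞 K)⁰ (FractionRing (𝓞 K)))⁻¹,
          ∃ G : MvPolynomial (Fin 2) (𝓞 K),
            MvPolynomial.map (algebraMap (𝓞 K) (FractionRing (𝓞 K))) G =
              x • MvPolynomial.map (algebraMap (𝓞 K) (FractionRing (𝓞 K))) (F P) ∧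
            z = Ideal.Quotient.mk (Ideal.span {quadPoly a b c}) G}))
    (H : Ideal (QuadAlg (𝓞 K) a b c))
    (hH : H = ∏ P ∈ hfin.toFinset, I P)
    (M : Ideal (QuadAlg (𝓞 K) a b c)) [M.IsPrime] :
    ¬ IsRegularLocal (Localization.AtPrime M) ↔ H ≤ M := by
  have hf0 := quadPoly_ne_zero a b c
  set φ := Ideal.Quotient.mk (Ideal.span {quadPoly a b c}) with hφ
  set N := M.comap φ with hN
  have hNp : N.IsPrime := Ideal.comap_isPrime φ M
  have hφf : φ (quadPoly a b c) = 0 :=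
    Ideal.Quotient.eq_zero_iff_mem.mpr (Ideal.mem_span_singleton_self _)
  have hfN : quadPoly a b c ∈ N := by rw [hN, Ideal.mem_comap, hφf]; exact zero_mem _
  have hsing : ¬ IsRegularLocal (Localization.AtPrime M) ↔
      ∃ s, s ∉ N ∧ s * quadPoly a b c ∈ N ^ 2 := by
    rw [isRegularLocal_localization_iff φ Ideal.Quotient.mk_surjective M N hN hf0 hφf (t := 1)
      ((Ideal.ne_top_iff_one N).mp hNp.ne_top) fun y hy => by
        rw [one_mul]
        exact Ideal.mem_span_singleton.mp (Ideal.Quotient.eq_zero_iff_mem.mp hy)]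
    push Not
    rfl
  have hΓmax : ∀ P ∈ Γ, P ≠ ⊥ ∧ P.IsMaximal := by
    intro P hP
    rw [hΓ] at hP
    obtain ⟨hPp, h2b, -⟩ := hP
    have hP0 : P ≠ ⊥ := by
      rintro rfl
      have : (2 : 𝓞 K) ∈ (⊥ : Ideal (𝓞 K)) := h2b (Ideal.subset_span (by simp))
      exact two_ne_zero (Ideal.mem_bot.mp this)
    exact ⟨hP0, hPp.isMaximal hP0⟩
  have hIM : ∀ P ∈ Γ, N.comap C = P →
      (I P ≤ M ↔ ∃ s, s ∉ N ∧ s * quadPoly a b c ∈ N ^ 2) := by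
    intro P hPΓ hNP
    have hP := hPΓ
    rw [hΓ] at hP
    obtain ⟨hPp, h2b, hac⟩ := hP
    obtain ⟨hP0, hPm⟩ := hΓmax P hPΓ
    obtain ⟨hFP, hiff⟩ := exists_mul_quadPoly_mem_sq_iff hNP h2b hac (hd P hPΓ) (he P hPΓ)
      (hF₁ P hPΓ) (hF₂ P hPΓ) hfN
    rw [hiff, ← forall_inv_smul_mem_iff P hP0 N hNP (F P) hFP, hI P hPΓ, Ideal.span_le,
      Set.union_subset_iff]
    constructor
    · rintro ⟨-, h⟩ x hx G hG
      exact h ⟨x, hx, G, hG, rfl⟩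
    · intro h
      refine ⟨?_, ?_⟩
      · rintro _ ⟨r, hr, rfl⟩
        rw [← hNP] at hr
        exact hr
      · rintro _ ⟨x, hx, G, hG, rfl⟩
        exact h x hx G hG
  rw [hsing, hH, Ideal.IsPrime.prod_le ‹_›]
  constructor
  · rintro ⟨s, hs, hsf⟩
    have hΓ' : N.comap C ∈ Γ := by
      rw [hΓ]
      exact ⟨Ideal.comap_isPrime C N, comap_C_of_mul_quadPoly_mem_sq hs hfN hsf⟩
    exact ⟨N.comap C, hfin.mem_toFinset.mpr hΓ', (hIM _ hΓ' rfl).mpr ⟨s, hs, hsf⟩⟩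
  · rintro ⟨P, hPΓ, hle⟩
    rw [hfin.mem_toFinset] at hPΓ
    refine (hIM P hPΓ ?_).mp hle
    refine ((hΓmax P hPΓ).2.eq_of_le (Ideal.comap_isPrime C N).ne_top fun r hr => ?_).symm
    apply hle
    rw [hI P hPΓ]
    exact Ideal.subset_span (Or.inl ⟨r, hr, rfl⟩)
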